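/- Let n ≥ 4 be even. For j ∈ ZMod n and μ ∈ {1,2,3}, let T_{μ,j} denote the n-qubit Pauli string taking value μ at positions j and j+1 (indices mod n) and 0 elsewhere (i.e., the strings X_j X_{j+1}, Y_j Y_{j+1}, Z_j Z_{j+1}), and let 𝒢 = {T_{μ,j} : μ ∈ {1,2,3}, j ∈ ZMod n}. Let 𝒢_Lie be the Lie closure of 𝒢, i.e., the smallest Lie-closed set of n-qubit Pauli strings containing 𝒢. Then 𝒢_Lie equals the set of all n-qubit Pauli strings that commute with each of the three global strings ∏_j X_j (the string f ≡ 1), ∏_j Y_j (f ≡ 2), and ∏_j Z_j (f ≡ 3), excluding the four strings {identity, ∏_j X_j, ∏_j Y_j, ∏_j Z_j}; consequently the cardinality of 𝒢_Lie equals 4^n / 4 − 4. -/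

import Mathlib

open Matrix

noncomputable section

/-- The four single-qubit Pauli matrices: I, X, Y, Z. -/
def pauli1 : Fin 4 → Matrix (Fin 2) (Fin 2) ℂ :=
  ![1, !![0, 1; 1, 0], !![0, -Complex.I; Complex.I, 0], !![1, 0; 0, -1]]

/-- The `n`-qubit Pauli string determined by `f : Fin n → Fin 4`. -/
def PauliString (n : ℕ) (f : Fin n → Fin 4) :
    Matrix (Fin n → Fin 2) (Fin n → Fin 2) ℂ :=
  fun x y => ∏ i, pauli1 (f i) (x i) (y i)

/-- Two matrices commute. -/
def MComm {n : ℕ} (A B : Matrix (Fin n → Fin 2) (Fin n → Fin 2) ℂ) : Prop :=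
  A * B = B * A

/-- Two matrices anticommute. -/
def MAntiComm {n : ℕ} (A B : Matrix (Fin n → Fin 2) (Fin n → Fin 2) ℂ) : Prop :=
  A * B = -(B * A)

/-- A matrix is an `n`-qubit Pauli string. -/
def IsPauli {n : ℕ} (A : Matrix (Fin n → Fin 2) (Fin n → Fin 2) ℂ) : Prop :=
  ∃ f : Fin n → Fin 4, A = PauliString n f

/-- A set of `n`-qubit Pauli strings is Lie-closed: whenever two of its members
anticommute, the (unique) Pauli string appearing, up to a unit scalar, in their
product also belongs to the set. -/
def LieClosed {n : ℕ} (𝒢 : Set (Matrix (Fin n → Fin 2) (Fin n → Fin 2) ℂ)) : Prop :=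
  ∀ P ∈ 𝒢, ∀ Q ∈ 𝒢, MAntiComm P Q →
    ∀ (c : ℂ) (R : Matrix (Fin n → Fin 2) (Fin n → Fin 2) ℂ),
      ‖c‖ = 1 → IsPauli R → P * Q = c • R → R ∈ 𝒢

/-- `P` and `Q` are `𝔤`-connected with respect to `𝒢`: they are distinct and
joined by a chain of anticommutations passing through elements of `𝒢`
(the empty chain meaning that `P` and `Q` themselves anticommute). -/
def GConnected {n : ℕ} (𝒢 : Set (Matrix (Fin n → Fin 2) (Fin n → Fin 2) ℂ))
    (P Q : Matrix (Fin n → Fin 2) (Fin n → Fin 2) ℂ) : Prop :=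
  P ≠ Q ∧ ∃ l : List (Matrix (Fin n → Fin 2) (Fin n → Fin 2) ℂ),
    (∀ R ∈ l, R ∈ 𝒢) ∧ List.Chain' MAntiComm (P :: (l ++ [Q]))

/-- The generator `T_{μ,j}`: the `n`-qubit Pauli string taking the value `μ` at
positions `j` and `j+1` (mod `n`) and the identity elsewhere. -/
def pairGen (n : ℕ) (μ : Fin 4) (j : ZMod n) :
    Matrix (Fin n → Fin 2) (Fin n → Fin 2) ℂ :=
  PauliString n fun i =>
    if ((i : ℕ) : ZMod n) = j ∨ ((i : ℕ) : ZMod n) = j + 1 then μ else 0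

/-- The generating set `𝒢 = {X_j X_{j+1}, Y_j Y_{j+1}, Z_j Z_{j+1} : j ∈ ZMod n}`. -/
def symGens (n : ℕ) : Set (Matrix (Fin n → Fin 2) (Fin n → Fin 2) ℂ) :=
  {A | ∃ (μ : Fin 4) (j : ZMod n), (μ = 1 ∨ μ = 2 ∨ μ = 3) ∧ A = pairGen n μ j}

/-- The Lie closure of a set of Pauli strings: the smallest Lie-closed set
containing it. -/
def lieClosure {n : ℕ} (𝒢 : Set (Matrix (Fin n → Fin 2) (Fin n → Fin 2) ℂ)) :
    Set (Matrix (Fin n → Fin 2) (Fin n → Fin 2) ℂ) :=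
  ⋂₀ {𝒯 | LieClosed 𝒯 ∧ 𝒢 ⊆ 𝒯}


/-! ### The symplectic description of Pauli strings -/

/-- The single-qubit Pauli group modulo phases: `X = (1, 0)`, `Z = (0, 1)`, `Y = (1, 1)`. -/
abbrev PauliVec : Type := ZMod 2 × ZMod 2

/-- Labels of single-qubit Pauli matrices. -/
def pauliLabel : PauliVec ≃ Fin 4 where
  toFun a := if a = (0, 0) then 0 else if a = (1, 0) then 1 else if a = (1, 1) then 2 else 3
  invFun := ![(0, 0), (1, 0), (1, 1), (0, 1)]
  left_inv := by decide
  right_inv := by decide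

/-- The symplectic form on `PauliVec`. -/
def symp (a b : PauliVec) : ZMod 2 := a.1 * b.2 + a.2 * b.1

/-- The sign character of `ZMod 2`. -/
def signChar (t : ZMod 2) : ℂ := if t = 0 then 1 else -1

/-- The Pauli string with a given symplectic vector. -/
def pauliOf {n : ℕ} (f : Fin n → PauliVec) : Matrix (Fin n → Fin 2) (Fin n → Fin 2) ℂ :=
  PauliString n fun i => pauliLabel (f i)

lemma pauliVec_cases : ∀ a : PauliVec, a = (0, 0) ∨ a = (1, 0) ∨ a = (1, 1) ∨ a = (0, 1) := by
  decide

lemma pauliLabel_zero : pauliLabel 0 = 0 := by decide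
lemma pauliLabel_one_zero : pauliLabel (1, 0) = 1 := by decide
lemma pauliLabel_one_one : pauliLabel (1, 1) = 2 := by decide
lemma pauliLabel_zero_one : pauliLabel (0, 1) = 3 := by decide

lemma signChar_add (s t : ZMod 2) : signChar (s + t) = signChar s * signChar t := by
  have h : ∀ u : ZMod 2, u = 0 ∨ u = 1 := by decide
  have h2 : (1 + 1 : ZMod 2) = 0 := by decide
  rcases h s with rfl | rfl <;> rcases h t with rfl | rfl <;> simp [signChar, h2]

lemma signChar_sum {ι : Type*} (s : Finset ι) (t : ι → ZMod 2) :
    signChar (∑ i ∈ s, t i) = ∏ i ∈ s, signChar (t i) := by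
  classical
  induction s using Finset.induction_on with
  | empty => simp [signChar]
  | insert a s ha ih => rw [Finset.sum_insert ha, Finset.prod_insert ha, signChar_add, ih]

lemma pauli1_mul (a b : PauliVec) : ∃ c : ℂ, ‖c‖ = 1 ∧
    pauli1 (pauliLabel a) * pauli1 (pauliLabel b) = c • pauli1 (pauliLabel (a + b)) := by
  have h2 : (1 + 1 : ZMod 2) = 0 := by decide
  have h0 : pauliLabel (0, 0) = 0 := by decide
  have key : ∀ a b : PauliVec, (∃ c ∈ ({1, Complex.I, -Complex.I} : Set ℂ),
      pauli1 (pauliLabel a) * pauli1 (pauliLabel b) = c • pauli1 (pauliLabel (a + b))) := by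
    intro a b
    rcases pauliVec_cases a with rfl | rfl | rfl | rfl <;>
    rcases pauliVec_cases b with rfl | rfl | rfl | rfl <;>
    simp [h0, h2, pauliLabel_one_zero, pauliLabel_one_one, pauliLabel_zero_one,
      pauli1, Matrix.one_fin_two]
  obtain ⟨c, hc, h⟩ := key a b
  refine ⟨c, ?_, h⟩
  rcases hc with rfl | rfl | rfl <;> simp

lemma pauli1_mul_comm (a b : PauliVec) :
    pauli1 (pauliLabel a) * pauli1 (pauliLabel b) =
      signChar (symp a b) • (pauli1 (pauliLabel b) * pauli1 (pauliLabel a)) := by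
  have h2 : (1 + 1 : ZMod 2) = 0 := by decide
  have h0 : pauliLabel (0, 0) = 0 := by decide
  rcases pauliVec_cases a with rfl | rfl | rfl | rfl <;>
  rcases pauliVec_cases b with rfl | rfl | rfl | rfl <;>
  simp [h0, h2, pauliLabel_one_zero, pauliLabel_one_one, pauliLabel_zero_one,
    pauli1, Matrix.one_fin_two, symp, signChar]

lemma symp_add_left (a b c : PauliVec) : symp (a + b) c = symp a c + symp b c := by
  simp only [symp, Prod.fst_add, Prod.snd_add]; ring

lemma symp_add_right (a b c : PauliVec) : symp a (b + c) = symp a b + symp a c := by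
  simp only [symp, Prod.fst_add, Prod.snd_add]; ring

lemma symp_self : ∀ a : PauliVec, symp a a = 0 := by decide

lemma symp_sum_left {ι : Type*} (s : Finset ι) (f : ι → PauliVec) (a : PauliVec) :
    ∑ i ∈ s, symp (f i) a = symp (∑ i ∈ s, f i) a := by
  simp only [symp, Prod.fst_sum, Prod.snd_sum, Finset.sum_add_distrib, Finset.sum_mul]

lemma pauliVec_add_self : ∀ a : PauliVec, a + a = 0 := by decide

/-- The symplectic form on strings. -/
def sympForm {ι : Type*} [Fintype ι] (f g : ι → PauliVec) : ZMod 2 := ∑ i, symp (f i) (g i)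

/-- The vector with value `t` at positions `i` and `j`. -/
def pairVec {ι : Type*} [DecidableEq ι] (i j : ι) (t : PauliVec) : ι → PauliVec :=
  Pi.single i t + Pi.single j t

section Combinatorics

variable {ι : Type*} [DecidableEq ι]

lemma pairVec_comm (i j : ι) (t : PauliVec) : pairVec i j t = pairVec j i t := add_comm _ _

lemma pairVec_add_cancel (f : ι → PauliVec) (i j : ι) (t : PauliVec) :
    f + pairVec i j t + pairVec i j t = f := by
  ext1 k
  simp [add_assoc, pauliVec_add_self]

lemma pairVec_left {i j : ι} (h : i ≠ j) (t : PauliVec) : pairVec i j t i = t := by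
  simp [pairVec, h]

lemma pairVec_right {i j : ι} (h : i ≠ j) (t : PauliVec) : pairVec i j t j = t := by
  simp [pairVec, h.symm]

lemma pairVec_of_ne {i j k : ι} (hi : k ≠ i) (hj : k ≠ j) (t : PauliVec) :
    pairVec i j t k = 0 := by
  simp [pairVec, hi, hj]

variable [Fintype ι]

lemma sympForm_single (f : ι → PauliVec) (i : ι) (t : PauliVec) :
    sympForm f (Pi.single i t) = symp (f i) t := by
  rw [sympForm, Finset.sum_eq_single i]
  · simp
  · intro k _ hk
    simp [Pi.single_eq_of_ne hk, symp]
  · simp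

lemma sympForm_pairVec (f : ι → PauliVec) (i j : ι) (t : PauliVec) :
    sympForm f (pairVec i j t) = symp (f i + f j) t := by
  rw [symp_add_left, ← sympForm_single, ← sympForm_single]
  simp [sympForm, pairVec, symp_add_right, Finset.sum_add_distrib]

lemma sum_pairVec (i j : ι) (t : PauliVec) : ∑ k, pairVec i j t k = 0 := by
  simp [pairVec, Finset.sum_add_distrib, pauliVec_add_self]

variable {G : Set (ι → PauliVec)}

lemma mem_of_add_pairVec_mem_of_symp
    (hG : ∀ f ∈ G, ∀ g ∈ G, sympForm f g = 1 → f + g ∈ G)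
    (hP : ∀ i j, i ≠ j → ∀ t, t ≠ 0 → pairVec i j t ∈ G)
    {f : ι → PauliVec} {i j : ι} (hij : i ≠ j) {t : PauliVec}
    (ht : symp (f i + f j) t = 1) (hf : f + pairVec i j t ∈ G) : f ∈ G := by
  have ht0 : t ≠ 0 := by
    rintro rfl
    simp [symp] at ht
  rw [← pairVec_add_cancel f i j t]
  refine hG _ hf _ (hP i j hij t ht0) ?_
  rw [sympForm_pairVec, Pi.add_apply, Pi.add_apply, pairVec_left hij, pairVec_right hij,
    add_add_add_comm, pauliVec_add_self, add_zero, ht]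

/-- Two distinct entries may be shifted by any common amount. -/
lemma mem_of_add_pairVec_mem
    (hG : ∀ f ∈ G, ∀ g ∈ G, sympForm f g = 1 → f + g ∈ G)
    (hP : ∀ i j, i ≠ j → ∀ t, t ≠ 0 → pairVec i j t ∈ G)
    {f : ι → PauliVec} {i j : ι} (hf : f i ≠ f j) (t : PauliVec)
    (h : f + pairVec i j t ∈ G) : f ∈ G := by
  have hij : i ≠ j := fun e => hf (e ▸ rfl)
  have key : ∀ a b t : PauliVec, a ≠ b → t = 0 ∨ symp (a + b) t = 1 ∨
      ∃ u w, t = u + w ∧ symp (a + b) u = 1 ∧ symp (a + b) w = 1 := by decide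
  rcases key _ _ t hf with rfl | h1 | ⟨u, w, rfl, hu, hw⟩
  · simpa [pairVec] using h
  · exact mem_of_add_pairVec_mem_of_symp hG hP hij h1 h
  · refine mem_of_add_pairVec_mem_of_symp hG hP hij hu
      (mem_of_add_pairVec_mem_of_symp hG hP hij (t := w) ?_ ?_)
    · rw [Pi.add_apply, Pi.add_apply, pairVec_left hij, pairVec_right hij,
        add_add_add_comm, pauliVec_add_self, add_zero, hw]
    · convert h using 1
      simp only [pairVec, Pi.single_add]
      abel

/-- A set of vectors closed under sums of non-orthogonal elements and containing all two-site
vectors contains every non-constant vector of total sum zero. -/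
theorem mem_of_sum_eq_zero
    (hG : ∀ f ∈ G, ∀ g ∈ G, sympForm f g = 1 → f + g ∈ G)
    (hP : ∀ i j, i ≠ j → ∀ t, t ≠ 0 → pairVec i j t ∈ G)
    (f : ι → PauliVec) (hsum : ∑ i, f i = 0) (hne : ∃ i j, f i ≠ f j) : f ∈ G := by
  induction hm : (Finset.univ.filter fun i => f i ≠ 0).card using Nat.strong_induction_on
    generalizing f with
  | _ m ih =>
  subst hm
  by_cases hA : ∃ i j, f i ≠ 0 ∧ f j ≠ 0 ∧ f i ≠ f j
  · obtain ⟨i, j, hi, hj, hfij⟩ := hA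
    have hij : i ≠ j := fun e => hfij (e ▸ rfl)
    have hi' : (f + pairVec i j (f i)) i = 0 := by
      rw [Pi.add_apply, pairVec_left hij, pauliVec_add_self]
    have hj' : (f + pairVec i j (f i)) j = f j + f i := by
      rw [Pi.add_apply, pairVec_right hij]
    refine mem_of_add_pairVec_mem hG hP hfij (f i) (ih _ ?_ _ ?_ ?_ rfl)
    · refine Finset.card_lt_card (Finset.ssubset_iff_subset_ne.2 ⟨fun k hk => ?_, fun e => ?_⟩)
      · rw [Finset.mem_filter] at hk ⊢
        refine ⟨hk.1, fun hk0 => ?_⟩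
        have hki : k ≠ i := fun e => hi (e ▸ hk0)
        have hkj : k ≠ j := fun e => hj (e ▸ hk0)
        exact hk.2 (by rw [Pi.add_apply, pairVec_of_ne hki hkj, hk0, add_zero])
      · have : i ∈ Finset.univ.filter fun k => f k ≠ 0 := by simpa using hi
        rw [← e, Finset.mem_filter] at this
        exact this.2 hi'
    · simp only [Pi.add_apply, Finset.sum_add_distrib, hsum, sum_pairVec, add_zero]
    · refine ⟨i, j, ?_⟩
      rw [hi', hj']
      revert hfij
      generalize f i = a
      generalize f j = b
      revert a b
      decide
  · push Not at hA
    obtain ⟨q, hq⟩ : ∃ q, f q ≠ 0 := by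
      obtain ⟨i, j, hij⟩ := hne
      by_contra! h
      exact hij ((h i).trans (h j).symm)
    obtain ⟨p, hp⟩ : ∃ p, f p = 0 := by
      obtain ⟨i, j, hij⟩ := hne
      by_contra! h
      exact hij (hA i j (h i) (h j))
    have hval : ∀ i, f i ≠ 0 → f i = f q := fun i hi => hA i q hi hq
    obtain ⟨r, hrq, hr⟩ : ∃ r, r ≠ q ∧ f r ≠ 0 := by
      by_contra! h
      rw [Finset.sum_eq_single q (fun k _ hk => h k hk) (by simp)] at hsum
      exact hq hsum
    by_cases hs : ∃ s, s ≠ q ∧ s ≠ r ∧ f s ≠ 0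
    · obtain ⟨s, hsq, hsr, hs⟩ := hs
      have hpq : p ≠ q := fun e => hq (e ▸ hp)
      have hpr : p ≠ r := fun e => hr (e ▸ hp)
      have hps : p ≠ s := fun e => hs (e ▸ hp)
      obtain ⟨b, hb0, hba⟩ : ∃ b : PauliVec, b ≠ 0 ∧ b ≠ f q := by
        generalize f q = a
        revert a
        decide
      have hfr := hval r hr
      have hfs := hval s hs
      refine mem_of_add_pairVec_mem hG hP (i := p) (j := q) (by rw [hp]; exact hq.symm) b
        (mem_of_add_pairVec_mem hG hP (i := q) (j := r) ?_ (f q + b)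
        (mem_of_add_pairVec_mem hG hP (i := r) (j := s) ?_ b (ih _ ?_ _ ?_ ?_ rfl)))
      · simp only [Pi.add_apply, pairVec_right hpq, pairVec_of_ne hpr.symm hrq, hfr]
        simpa using hb0
      · simp only [Pi.add_apply, pairVec_right hrq.symm, pairVec_of_ne hpr.symm hrq,
          pairVec_of_ne hps.symm hsq, pairVec_of_ne hsq hsr, hfr, hfs]
        revert hba
        generalize f q = a
        revert a b
        decide
      · have hsub : (Finset.univ.filter fun k => (f + pairVec p q b + pairVec q r (f q + b) +
            pairVec r s b) k ≠ 0) ⊆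
            insert p (((Finset.univ.filter fun k => f k ≠ 0).erase q).erase r) := by
          intro k hk
          rw [Finset.mem_filter] at hk
          simp only [Finset.mem_insert, Finset.mem_erase, Finset.mem_filter, Finset.mem_univ,
            true_and]
          by_contra! hcon
          obtain ⟨hkp, hkr⟩ := hcon
          apply hk.2
          by_cases hr' : k = r
          · subst hr'
            simp only [Pi.add_apply, pairVec_right hrq.symm, pairVec_of_ne hpr.symm hrq,
              pairVec_left hsr.symm, hfr]
            clear hk hba hb0
            generalize f q = a
            revert a b
            decide
          by_cases hq' : k = q
          · subst hq'
            simp only [Pi.add_apply, pairVec_right hpq, pairVec_left hrq.symm,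
              pairVec_of_ne hrq.symm hsq.symm]
            clear hk hba hb0
            generalize f k = a
            revert a b
            decide
          have hk0 : f k = 0 := hkr hr' hq'
          have hks : k ≠ s := fun e => hs (e ▸ hk0)
          simp only [Pi.add_apply, pairVec_of_ne hkp hq', pairVec_of_ne hq' hr',
            pairVec_of_ne hr' hks, hk0, add_zero]
        have hq1 : q ∈ Finset.univ.filter fun k => f k ≠ 0 := by simpa using hq
        have hr1 : r ∈ (Finset.univ.filter fun k => f k ≠ 0).erase q := by
          simpa using ⟨hrq, hr⟩
        have h1 := Finset.card_le_card hsub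
        have h2 := Finset.card_insert_le p
          (((Finset.univ.filter fun k => f k ≠ 0).erase q).erase r)
        have h3 := Finset.card_erase_add_one hq1
        have h4 := Finset.card_erase_add_one hr1
        omega
      · simp only [Pi.add_apply, Finset.sum_add_distrib, hsum, sum_pairVec, add_zero]
      · refine ⟨p, q, ?_⟩
        simp only [Pi.add_apply, pairVec_left hpq, pairVec_right hpq, pairVec_of_ne hpq hpr,
          pairVec_of_ne hpr hps, pairVec_left hrq.symm, pairVec_of_ne hrq.symm hsq.symm, hp]
        clear hba
        revert hb0
        generalize f q = a
        revert a b
        decide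
    · push Not at hs
      convert hP q r hrq.symm (f q) hq using 1
      ext1 k
      by_cases h1 : k = q
      · rw [h1, pairVec_left hrq.symm]
      by_cases h2 : k = r
      · rw [h2, pairVec_right hrq.symm, hval r hr]
      rw [hs k h1 h2, pairVec_of_ne h1 h2]

lemma pairVec_trans
    (hG : ∀ f ∈ G, ∀ g ∈ G, sympForm f g = 1 → f + g ∈ G)
    {i j k : ι} (hij : i ≠ j) (hjk : j ≠ k) (hik : i ≠ k)
    (h1 : ∀ t, t ≠ 0 → pairVec i j t ∈ G) (h2 : ∀ t, t ≠ 0 → pairVec j k t ∈ G)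
    {t : PauliVec} (ht : t ≠ 0) : pairVec i k t ∈ G := by
  obtain ⟨u, hu0, hut, htu⟩ : ∃ u : PauliVec, u ≠ 0 ∧ t + u ≠ 0 ∧ symp t u = 1 := by
    revert t
    decide
  have e1 : pairVec i j t + pairVec j k u ∈ G := by
    refine hG _ (h1 t ht) _ (h2 u hu0) ?_
    rw [sympForm_pairVec, pairVec_right hij, pairVec_of_ne hik.symm hjk.symm, add_zero, htu]
  have e2 := hG _ e1 _ (h2 (t + u) hut) (by
    rw [sympForm_pairVec, Pi.add_apply, Pi.add_apply, pairVec_right hij,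
      pairVec_of_ne hik.symm hjk.symm, pairVec_left hjk, pairVec_right hjk]
    clear e1
    revert t u
    decide)
  convert e2 using 1
  have hz : ∀ t u : PauliVec, t + u + (t + u) = 0 := by decide
  have hw : ∀ t u : PauliVec, t = u + (t + u) := by decide
  ext1 l
  by_cases hi : l = i
  · subst hi
    simp [pairVec_left hij, pairVec_left hik, pairVec_of_ne hij hik]
  by_cases hj : l = j
  · subst hj
    simp [pairVec_right hij, pairVec_left hjk, pairVec_of_ne hij.symm hjk, hz]
  by_cases hk : l = k
  · subst hk
    simp only [Pi.add_apply, pairVec_right hjk, pairVec_right hik, pairVec_of_ne hik.symm hjk.symm,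
      zero_add]
    exact hw _ _
  simp [pairVec_of_ne hi hj, pairVec_of_ne hi hk, pairVec_of_ne hj hk]

end Combinatorics

/-- Two-site vectors on neighbouring sites generate those on arbitrary sites. -/
lemma pairVec_mem_of_adjacent {n : ℕ} {G : Set (Fin n → PauliVec)}
    (hG : ∀ f ∈ G, ∀ g ∈ G, sympForm f g = 1 → f + g ∈ G)
    (hadj : ∀ i j : Fin n, (j : ℕ) = i + 1 → ∀ t, t ≠ 0 → pairVec i j t ∈ G)
    (i j : Fin n) (hij : i ≠ j) (t : PauliVec) (ht : t ≠ 0) : pairVec i j t ∈ G := by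
  have key : ∀ (d : ℕ) (i j : Fin n), (j : ℕ) = i + d + 1 → ∀ t, t ≠ 0 → pairVec i j t ∈ G := by
    intro d
    induction d with
    | zero => exact hadj
    | succ d ih =>
      intro i j h t ht
      have hlt : (i : ℕ) + d + 1 < n := by omega
      refine pairVec_trans (j := ⟨i + d + 1, hlt⟩) hG ?_ ?_ ?_ (ih i _ rfl)
        (hadj _ j (by simp only [add_assoc]; omega)) ht <;>
      · rw [Ne, Fin.ext_iff]
        grind
  rcases lt_or_gt_of_ne hij with h | h
  · exact key (j - i - 1) i j (by omega) t ht
  · rw [pairVec_comm]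
    exact key (i - j - 1) j i (by omega) t ht

/-! ### Products of Pauli strings -/

lemma pauliOf_mul_apply {n : ℕ} (f g : Fin n → PauliVec) (x y : Fin n → Fin 2) :
    (pauliOf f * pauliOf g) x y =
      ∏ i, (pauli1 (pauliLabel (f i)) * pauli1 (pauliLabel (g i))) (x i) (y i) := by
  simp only [Matrix.mul_apply, pauliOf, PauliString, ← Finset.prod_mul_distrib,
    Finset.prod_univ_sum, Fintype.piFinset_univ]

lemma pauliOf_mul {n : ℕ} (f g : Fin n → PauliVec) :
    ∃ c : ℂ, ‖c‖ = 1 ∧ pauliOf f * pauliOf g = c • pauliOf (f + g) := by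
  choose c hc h using fun i => pauli1_mul (f i) (g i)
  refine ⟨∏ i, c i, by simp [norm_prod, hc], ?_⟩
  ext x y
  rw [pauliOf_mul_apply]
  simp only [h, Matrix.smul_apply, smul_eq_mul, Finset.prod_mul_distrib,
    pauliOf, PauliString, Pi.add_apply]

lemma pauliOf_mul_comm {n : ℕ} (f g : Fin n → PauliVec) :
    pauliOf f * pauliOf g = signChar (sympForm f g) • (pauliOf g * pauliOf f) := by
  ext x y
  simp [pauliOf_mul_apply, pauli1_mul_comm (f _) (g _), sympForm, signChar_sum,
    Finset.prod_mul_distrib]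

lemma pauliOf_zero {n : ℕ} : pauliOf (0 : Fin n → PauliVec) = 1 := by
  ext x y
  by_cases h : x = y
  · subst h
    simp [pauliOf, PauliString, pauliLabel_zero, pauli1]
  · obtain ⟨i, hi⟩ := Function.ne_iff.1 h
    rw [Matrix.one_apply_ne h]
    exact Finset.prod_eq_zero (Finset.mem_univ i) (by simp [pauliLabel_zero, pauli1, hi])

lemma pauliOf_mul_ne_zero {n : ℕ} (f g : Fin n → PauliVec) : pauliOf f * pauliOf g ≠ 0 := by
  have hne : ∀ h : Fin n → PauliVec, pauliOf h ≠ 0 := by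
    intro h h0
    obtain ⟨c, hc, e⟩ := pauliOf_mul h h
    have hhh : h + h = 0 := by
      ext1 i
      exact pauliVec_add_self _
    rw [hhh, h0, pauliOf_zero, zero_mul, eq_comm, smul_eq_zero] at e
    rcases e with rfl | e
    · simp at hc
    · exact one_ne_zero e
  obtain ⟨c, hc, e⟩ := pauliOf_mul f g
  rw [e]
  refine smul_ne_zero ?_ (hne _)
  rintro rfl
  simp at hc

lemma eq_of_smul_pauliOf_eq {n : ℕ} {f g : Fin n → PauliVec} {c : ℂ} (hc : c ≠ 0)
    (h : pauliOf f = c • pauliOf g) : f = g := by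
  have hs : ∀ k, signChar (sympForm f k) = signChar (sympForm g k) := by
    intro k
    have h1 := pauliOf_mul_comm f k
    rw [h, Matrix.smul_mul, Matrix.mul_smul, pauliOf_mul_comm g k, smul_smul, smul_smul] at h1
    have h2 := smul_left_injective ℂ (pauliOf_mul_ne_zero k g) h1
    rw [mul_comm] at h2
    exact (mul_right_cancel₀ hc h2).symm
  have hinj : ∀ s t : ZMod 2, signChar s = signChar t → s = t := by
    have hcase : ∀ u : ZMod 2, u = 0 ∨ u = 1 := by decide
    intro s t
    rcases hcase s with rfl | rfl <;> rcases hcase t with rfl | rfl <;>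
      norm_num [signChar]
  ext1 i
  have hsymp : ∀ t, symp (f i) t = symp (g i) t := fun t => by
    rw [← sympForm_single, ← sympForm_single]
    exact hinj _ _ (hs _)
  have key : ∀ a b : PauliVec, (∀ t, symp a t = symp b t) → a = b := by decide
  exact key _ _ hsymp

lemma pauliOf_injective {n : ℕ} :
    Function.Injective (pauliOf : (Fin n → PauliVec) → Matrix (Fin n → Fin 2) (Fin n → Fin 2) ℂ) :=
  fun f g h => eq_of_smul_pauliOf_eq one_ne_zero (by rw [h, one_smul])

lemma eq_zero_of_eq_neg {m : Type*} {A : Matrix m m ℂ} (h : A = -A) : A = 0 := by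
  ext x y
  exact self_eq_neg.1 (congrFun (congrFun h x) y)

lemma mComm_pauliOf {n : ℕ} (f g : Fin n → PauliVec) :
    MComm (pauliOf f) (pauliOf g) ↔ sympForm f g = 0 := by
  rw [MComm, pauliOf_mul_comm f g]
  constructor
  · intro h
    by_contra h0
    rw [signChar, if_neg h0, neg_one_smul] at h
    exact pauliOf_mul_ne_zero g f (eq_zero_of_eq_neg h.symm)
  · intro h
    simp [h, signChar]

lemma mAntiComm_pauliOf {n : ℕ} (f g : Fin n → PauliVec) :
    MAntiComm (pauliOf f) (pauliOf g) ↔ sympForm f g = 1 := by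
  have hcase : ∀ u : ZMod 2, u ≠ 0 → u = 1 := by decide
  rw [MAntiComm]
  constructor
  · intro h
    refine hcase _ fun h0 => ?_
    rw [← mComm_pauliOf, MComm] at h0
    rw [h0] at h
    exact pauliOf_mul_ne_zero g f (eq_zero_of_eq_neg h)
  · intro h
    rw [pauliOf_mul_comm, h]
    simp [signChar]

lemma isPauli_iff {n : ℕ} {A : Matrix (Fin n → Fin 2) (Fin n → Fin 2) ℂ} :
    IsPauli A ↔ ∃ f, A = pauliOf f := by
  constructor
  · rintro ⟨f, rfl⟩
    exact ⟨fun i => pauliLabel.symm (f i), by simp [pauliOf]⟩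
  · rintro ⟨f, rfl⟩
    exact ⟨_, rfl⟩

lemma PauliString_const {n : ℕ} (μ : Fin 4) :
    (PauliString n fun _ => μ) = pauliOf fun _ => pauliLabel.symm μ := by
  simp [pauliOf]

/-- The non-constant vectors of total sum zero. -/
def balancedVecs (n : ℕ) : Set (Fin n → PauliVec) :=
  {f | ∑ i, f i = 0} \ Set.range fun a _ => a

lemma balancedVecs_exists_ne {n : ℕ} (hn : 0 < n) {f : Fin n → PauliVec}
    (h : f ∈ balancedVecs n) : ∃ i j, f i ≠ f j := by
  by_contra! hcon
  exact h.2 ⟨f ⟨0, hn⟩, funext fun i => hcon _ _⟩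

lemma sympForm_const {n : ℕ} (f : Fin n → PauliVec) (a : PauliVec) :
    sympForm f (fun _ => a) = symp (∑ i, f i) a :=
  symp_sum_left _ _ _

lemma add_mem_balancedVecs {n : ℕ} {f g : Fin n → PauliVec} (hf : f ∈ balancedVecs n)
    (hg : g ∈ balancedVecs n) (h : sympForm f g = 1) : f + g ∈ balancedVecs n := by
  have hf0 : ∑ i, f i = 0 := hf.1
  have hg0 : ∑ i, g i = 0 := hg.1
  refine ⟨?_, ?_⟩
  · simp [Finset.sum_add_distrib, hf0, hg0]
  · rintro ⟨a, ha⟩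
    have hval : ∀ i, symp (f i) (g i) = symp (f i) a := by
      intro i
      have := congrFun ha i
      simp only [Pi.add_apply] at this
      rw [this, symp_add_right, symp_self, zero_add]
    have : sympForm f g = sympForm f (fun _ => a) := Finset.sum_congr rfl fun i _ => hval i
    rw [this, sympForm_const, hf0] at h
    simp [symp] at h

lemma pairVec_mem_balancedVecs {n : ℕ} (hn : 3 ≤ n) {i j : Fin n} (hij : i ≠ j) {t : PauliVec}
    (ht : t ≠ 0) : pairVec i j t ∈ balancedVecs n := by
  refine ⟨sum_pairVec i j t, ?_⟩
  rintro ⟨a, ha⟩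
  obtain ⟨k, hk⟩ : ∃ k, k ∉ ({i, j} : Finset (Fin n)) := by
    by_contra! h
    have h1 := Finset.card_le_card (fun k _ => h k : (Finset.univ : Finset (Fin n)) ⊆ {i, j})
    have h2 := Finset.card_le_two (a := i) (b := j)
    rw [Finset.card_univ, Fintype.card_fin] at h1
    omega
  simp only [Finset.mem_insert, Finset.mem_singleton, not_or] at hk
  have h1 := congrFun ha i
  have h2 := congrFun ha k
  rw [pairVec_left hij] at h1
  rw [pairVec_of_ne hk.1 hk.2] at h2
  exact ht (h1.symm.trans h2)

lemma pairGen_eq {n : ℕ} {i k : Fin n} (hik : i ≠ k) {j : ZMod n}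
    (hi : ((i : ℕ) : ZMod n) = j) (hk : ((k : ℕ) : ZMod n) = j + 1) (t : PauliVec) :
    pairGen n (pauliLabel t) j = pauliOf (pairVec i k t) := by
  have hinj : ∀ l m : Fin n, ((l : ℕ) : ZMod n) = ((m : ℕ) : ZMod n) ↔ l = m := by
    intro l m
    rw [ZMod.natCast_eq_natCast_iff', Nat.mod_eq_of_lt l.2, Nat.mod_eq_of_lt m.2, Fin.ext_iff]
  unfold pairGen pauliOf
  congr 1
  funext l
  simp only [← hk]
  simp only [← hi, hinj]
  by_cases h1 : l = i
  · subst h1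
    simp [pairVec_left hik]
  by_cases h2 : l = k
  · subst h2
    simp [pairVec_right hik]
  simp [h1, h2, pairVec_of_ne h1 h2, pauliLabel_zero]

lemma pauliLabel_ne_zero_iff : ∀ t : PauliVec,
    (pauliLabel t = 1 ∨ pauliLabel t = 2 ∨ pauliLabel t = 3) ↔ t ≠ 0 := by decide

/-- The Lie closure in terms of symplectic vectors. -/
theorem lieClosure_symGens_eq_image {n : ℕ} (hn : 3 ≤ n) :
    lieClosure (symGens n) = pauliOf '' balancedVecs n := by
  apply Set.Subset.antisymm
  · refine Set.sInter_subset_of_mem ⟨?_, ?_⟩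
    · rintro _ ⟨f, hf, rfl⟩ _ ⟨g, hg, rfl⟩ hfg c R hc hR h
      obtain ⟨r, rfl⟩ := isPauli_iff.1 hR
      rw [mAntiComm_pauliOf] at hfg
      obtain ⟨d, hd, e⟩ := pauliOf_mul f g
      have hc0 : c ≠ 0 := by
        rintro rfl
        simp at hc
      have hd0 : d ≠ 0 := by
        rintro rfl
        simp at hd
      have : pauliOf r = (c⁻¹ * d) • pauliOf (f + g) := by
        rw [mul_smul, ← e, h, inv_smul_smul₀ hc0]
      rw [eq_of_smul_pauliOf_eq (mul_ne_zero (inv_ne_zero hc0) hd0) this]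
      exact ⟨_, add_mem_balancedVecs hf hg hfg, rfl⟩
    · rintro _ ⟨μ, j, hμ, rfl⟩
      have : NeZero n := ⟨by omega⟩
      have : Fact (1 < n) := ⟨by omega⟩
      obtain ⟨t, rfl⟩ := pauliLabel.surjective μ
      have hik : (⟨j.val, ZMod.val_lt j⟩ : Fin n) ≠ ⟨(j + 1).val, ZMod.val_lt _⟩ := by
        intro h
        rw [Fin.mk.injEq] at h
        have := ZMod.val_injective n h
        simp at this
      refine ⟨_, pairVec_mem_balancedVecs hn hik ((pauliLabel_ne_zero_iff t).1 hμ),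
        (pairGen_eq hik ?_ ?_ t).symm⟩
      · simp
      · exact ZMod.natCast_zmod_val _
  · rintro _ ⟨f, hf, rfl⟩ 𝒯 ⟨hclosed, hgen⟩
    have hG : ∀ f ∈ {f | pauliOf f ∈ 𝒯}, ∀ g ∈ {f : Fin n → PauliVec | pauliOf f ∈ 𝒯},
        sympForm f g = 1 → f + g ∈ {f | pauliOf f ∈ 𝒯} := by
      intro f hf g hg hfg
      obtain ⟨c, hc, e⟩ := pauliOf_mul f g
      exact hclosed _ hf _ hg ((mAntiComm_pauliOf f g).2 hfg) c _ hc (isPauli_iff.2 ⟨_, rfl⟩) e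
    refine mem_of_sum_eq_zero hG (pairVec_mem_of_adjacent hG ?_) f hf.1
      (balancedVecs_exists_ne (by omega) hf)
    intro i j hij t ht
    have hne : i ≠ j := by
      rintro rfl
      omega
    exact hgen ⟨pauliLabel t, (i : ℕ), (pauliLabel_ne_zero_iff t).2 ht,
      (pairGen_eq hne rfl (by rw [hij]; push_cast; rfl) t).symm⟩

/-- The image of the balanced vectors, described through commutation. -/
theorem image_balancedVecs {n : ℕ} :
    pauliOf '' balancedVecs n =
      ({A | IsPauli A ∧
          MComm A (PauliString n fun _ => 1) ∧
          MComm A (PauliString n fun _ => 2) ∧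
          MComm A (PauliString n fun _ => 3)} \
        {PauliString n fun _ => 0, PauliString n fun _ => 1,
          PauliString n fun _ => 2, PauliString n fun _ => 3}) := by
  have hcomm : ∀ a : PauliVec, (symp a (pauliLabel.symm 1) = 0 ∧
      symp a (pauliLabel.symm 2) = 0 ∧ symp a (pauliLabel.symm 3) = 0) ↔ a = 0 := by decide
  have hconst : ∀ f : Fin n → PauliVec,
      f ∈ Set.range (fun (a : PauliVec) (_ : Fin n) => a) ↔
      (f = (fun _ => pauliLabel.symm 0) ∨ f = (fun _ => pauliLabel.symm 1) ∨
        f = (fun _ => pauliLabel.symm 2) ∨ f = fun _ => pauliLabel.symm 3) := by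
    intro f
    constructor
    · rintro ⟨a, rfl⟩
      obtain ⟨μ, rfl⟩ := pauliLabel.symm.surjective a
      fin_cases μ <;> simp
    · rintro (rfl | rfl | rfl | rfl) <;> exact ⟨_, rfl⟩
  have key : ∀ f : Fin n → PauliVec, f ∈ balancedVecs n ↔
      pauliOf f ∈ ({A | IsPauli A ∧
          MComm A (PauliString n fun _ => 1) ∧
          MComm A (PauliString n fun _ => 2) ∧
          MComm A (PauliString n fun _ => 3)} \
        {PauliString n fun _ => 0, PauliString n fun _ => 1,
          PauliString n fun _ => 2, PauliString n fun _ => 3}) := by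
    intro f
    have hp : IsPauli (pauliOf f) := isPauli_iff.2 ⟨f, rfl⟩
    simp only [PauliString_const, balancedVecs, Set.mem_sdiff, Set.mem_ofPred_eq, mComm_pauliOf,
      sympForm_const, hcomm, hp, true_and, hconst, Set.mem_insert_iff, Set.mem_singleton_iff,
      pauliOf_injective.eq_iff]
  ext A
  constructor
  · rintro ⟨f, hf, rfl⟩
    exact (key f).1 hf
  · intro hA
    obtain ⟨f, rfl⟩ := isPauli_iff.1 hA.1.1
    exact ⟨f, (key f).2 hA, rfl⟩

lemma ncard_sum_eq_zero {n : ℕ} (hn : 0 < n) :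
    {f : Fin n → PauliVec | ∑ i, f i = 0}.ncard = 4 ^ n / 4 := by
  let φ : (Fin n → PauliVec) →+ PauliVec :=
    { toFun := fun f => ∑ i, f i
      map_zero' := by simp
      map_add' := fun f g => by simp [Finset.sum_add_distrib] }
  have hsurj : Function.Surjective φ := fun a => ⟨Pi.single ⟨0, hn⟩ a, by simp [φ]⟩
  have h1 := φ.ker.card_mul_index
  rw [AddSubgroup.index_ker, AddMonoidHom.range_eq_top.2 hsurj] at h1
  have h2 : Nat.card (⊤ : AddSubgroup PauliVec) = 4 := by
    simp
  have h3 : Nat.card (Fin n → PauliVec) = 4 ^ n := by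
    simp [Nat.card_eq_fintype_card]
  have h4 : {f : Fin n → PauliVec | ∑ i, f i = 0}.ncard = Nat.card φ.ker := by
    rw [← Nat.card_coe_set_eq]
    rfl
  rw [h2, h3] at h1
  omega

lemma ncard_balancedVecs {n : ℕ} (hn : 0 < n) (heven : Even n) :
    (balancedVecs n).ncard = 4 ^ n / 4 - 4 := by
  rw [balancedVecs, Set.ncard_sdiff, ncard_sum_eq_zero hn]
  · congr 1
    have hinj : Function.Injective fun (a : PauliVec) (_ : Fin n) => a :=
      fun a b h => congrFun h ⟨0, hn⟩
    rw [← Set.image_univ, Set.ncard_image_of_injective _ hinj, Set.ncard_univ]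
    simp
  · rintro _ ⟨a, rfl⟩
    obtain ⟨m, rfl⟩ := heven
    change ∑ _i : Fin (m + m), a = 0
    rw [Finset.sum_const, Finset.card_univ, Fintype.card_fin, add_nsmul, pauliVec_add_self]

/-- **DLA of the symmetric ansatz.** For even `n ≥ 4`, the Lie
closure of `{X_j X_{j+1}, Y_j Y_{j+1}, Z_j Z_{j+1}}_j` is exactly the set of
Pauli strings commuting with `∏ X`, `∏ Y`, and `∏ Z`, with the four strings
`{I, ∏ X, ∏ Y, ∏ Z}` removed; in particular its cardinality is `4^n / 4 - 4`. -/
theorem dla_of_local_symmetric_ansatz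
    (n : ℕ) (hn : 4 ≤ n) (heven : Even n) :
    lieClosure (symGens n) =
      ({A | IsPauli A ∧
          MComm A (PauliString n fun _ => 1) ∧
          MComm A (PauliString n fun _ => 2) ∧
          MComm A (PauliString n fun _ => 3)} \
        {PauliString n fun _ => 0, PauliString n fun _ => 1,
          PauliString n fun _ => 2, PauliString n fun _ => 3}) ∧
    (lieClosure (symGens n)).ncard = 4 ^ n / 4 - 4 := by
  rw [lieClosure_symGens_eq_image (by omega)]
  refine ⟨image_balancedVecs, ?_⟩
  rw [Set.ncard_image_of_injective _ pauliOf_injective, ncard_balancedVecs (by omega) heven]
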